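/- Let s ∈ ℤ_{>0}, and let u, v ∈ F with ν(u) = 0 and ν(v) > 0 (so u^{-1}v ∈ p_F ∩ O_F). Suppose k = [[a, b],[c, d]] ∈ K satisfies a − d ∈ p_E^s and c − u^{-1}v·b ∈ p_E^s. Then there exist a′, b′ ∈ O_E with a′ − a ∈ p_E^s and b′ − b ∈ p_E^s such that the matrix k′ = [[a′, b′],[b′·u^{-1}v, a′]] lies in K; in particular (k′)^{-1}·k ∈ K_s. -/

import Mathlib

open Matrix

noncomputable section

/-- A 2×2 matrix over `E`. -/
abbrev Mat (E : Type) := Matrix (Fin 2) (Fin 2) E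

/-- The context: `E/F` is the unramified quadratic extension of a finite extension `F` of
`ℚ_p` (`p` odd), encoded via the Galois involution `sig` (whose fixed field is `F`),
the valuation `nu` (normalized by `nu ϖ = 1` for a uniformizer `ϖ` of `F`),
a square root `sqeps` of a non-square unit `eps = sqeps^2` of `O_F`, the residue-field
cardinality `q` of `F`, and an additive character `psi'` of `F` trivial on `p_F` and
nontrivial on `O_F`. -/
structure USetting (E : Type) [Field E] where
  sig : E →+* E
  nu : E → WithTop ℤ
  sqeps : E
  pi : E
  q : ℕ
  psi' : E → ℂ
  sig_invol : ∀ x, sig (sig x) = x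
  sig_ne : ∃ x, sig x ≠ x
  nu_eq_top : ∀ x, nu x = ⊤ ↔ x = 0
  nu_mul : ∀ x y, nu (x * y) = nu x + nu y
  nu_add : ∀ x y, min (nu x) (nu y) ≤ nu (x + y)
  nu_sig : ∀ x, nu (sig x) = nu x
  nu_pi : nu pi = 1
  sig_pi : sig pi = pi
  sig_sqeps : sig sqeps = - sqeps
  nu_sqeps : nu sqeps = 0
  eps_not_square : ∀ y, sig y = y → y * y ≠ sqeps * sqeps
  gen : ∀ x : E, ∃ a b, sig a = a ∧ sig b = b ∧ x = a + b * sqeps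
  nu_two : nu 2 = 0
  charzero : ∀ n : ℕ, (n : E) = 0 → n = 0
  complete : ∀ f : ℕ → E, (∀ n : ℕ, ((n : ℤ) : WithTop ℤ) ≤ nu (f (n + 1) - f n)) →
    ∃ L, ∀ n : ℕ, ((n : ℤ) : WithTop ℤ) ≤ nu (L - f n)
  res_card : ∃ R : Finset E, R.card = q ∧ (∀ x ∈ R, sig x = x ∧ 0 ≤ nu x) ∧
    ∀ y : E, sig y = y → 0 ≤ nu y → ∃! x, x ∈ R ∧ 1 ≤ nu (y - x)
  psi'_mul : ∀ x y, sig x = x → sig y = y → psi' (x + y) = psi' x * psi' y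
  psi'_ne : ∀ x, sig x = x → psi' x ≠ 0
  psi'_triv : ∀ x, sig x = x → 1 ≤ nu x → psi' x = 1
  psi'_nontriv : ∃ x, sig x = x ∧ 0 ≤ nu x ∧ psi' x ≠ 1

variable {E : Type} [Field E]

/-- The matrix `w₀ = [[0,1],[1,0]]`. -/
def w0 (E : Type) [Field E] : Mat E := !![0, 1; 1, 0]

/-- `G = U(1,1)(F)`. -/
def Gset (S : USetting E) : Set (Mat E) :=
  {g | (g.map ⇑S.sig)ᵀ * w0 E * g = w0 E}

/-- `K = G ∩ GL₂(O_E)`: entries in `O_E` and determinant in `O_E^×`. -/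
def Kset (S : USetting E) : Set (Mat E) :=
  {g | g ∈ Gset S ∧ (∀ i j, 0 ≤ S.nu (g i j)) ∧ S.nu g.det = 0}

/-- The congruence filtration subgroup `K_n` (for `n ≥ 1`; `K_0 = K` as a set). -/
def Kfil (S : USetting E) (n : ℤ) : Set (Mat E) :=
  {g | g ∈ Kset S ∧ ∀ i j, (n : WithTop ℤ) ≤ S.nu ((g - 1) i j)}

/-- `𝓑 = B ∩ K`, the upper triangular matrices in `K`. -/
def Bcal (S : USetting E) : Set (Mat E) := {g | g ∈ Kset S ∧ g 1 0 = 0}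

/-- `E^1`, the norm-one elements of `E`. -/
def E1set (S : USetting E) : Set E := {x | x * S.sig x = 1}

/-- `O_F^×` as a subset of `E`. -/
def OFunits (S : USetting E) : Set E := {x | S.sig x = x ∧ S.nu x = 0}

/-- `O_E^×` as a subset of `E`. -/
def OEunits (S : USetting E) : Set E := {x | S.nu x = 0}

/-- A character of `E^×`, encoded as a function `E → ℂ` multiplicative and
nonvanishing on nonzero elements. -/
def IsChar (χ : E → ℂ) : Prop :=
  (∀ x y : E, x ≠ 0 → y ≠ 0 → χ (x * y) = χ x * χ y) ∧ ∀ x : E, x ≠ 0 → χ x ≠ 0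

/-- A group homomorphism `E^1 → ℂ^×`, encoded as a function `E → ℂ`. -/
def IsE1Hom (S : USetting E) (φ : E → ℂ) : Prop :=
  (∀ x ∈ E1set S, ∀ y ∈ E1set S, φ (x * y) = φ x * φ y) ∧ ∀ x ∈ E1set S, φ x ≠ 0

/-- A homomorphism into `ℂ^×` on a subset of matrices. -/
def IsHomOn (A : Set (Mat E)) (Ψ : Mat E → ℂ) : Prop :=
  (∀ x ∈ A, ∀ y ∈ A, Ψ (x * y) = Ψ x * Ψ y) ∧ ∀ x ∈ A, Ψ x ≠ 0

/-- `1 + p_E^n`. -/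
def onePE (S : USetting E) (n : ℤ) : Set E := {x | (n : WithTop ℤ) ≤ S.nu (x - 1)}

/-- `1 + p_F^n`. -/
def onePF (S : USetting E) (n : ℤ) : Set E :=
  {x | S.sig x = x ∧ (n : WithTop ℤ) ≤ S.nu (x - 1)}

/-- `χ` is trivial on a set. -/
def TrivOn (χ : E → ℂ) (s : Set E) : Prop := ∀ x ∈ s, χ x = 1

/-- `χ` has depth `r`: trivial on `1+p_E^{r+1}` and (if `r ≥ 1`) nontrivial on `1+p_E^r`. -/
def HasDepth (S : USetting E) (χ : E → ℂ) (r : ℕ) : Prop :=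
  TrivOn χ (onePE S ((r : ℤ) + 1)) ∧ (r = 0 ∨ ¬ TrivOn χ (onePE S (r : ℤ)))

/-- `χ` has true depth `r`: the depth of its restriction to `F^×` is `r`. -/
def HasTrueDepth (S : USetting E) (χ : E → ℂ) (r : ℕ) : Prop :=
  TrivOn χ (onePF S ((r : ℤ) + 1)) ∧ (r = 0 ∨ ¬ TrivOn χ (onePF S (r : ℤ)))

/-- `χ` has minimal depth `r`: its depth and true depth both equal `r`. -/
def MinDepth (S : USetting E) (χ : E → ℂ) (r : ℕ) : Prop :=
  HasDepth S χ r ∧ HasTrueDepth S χ r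

/-- Right translation action on functions. -/
def rho (g : Mat E) : (Mat E → ℂ) →ₗ[ℂ] (Mat E → ℂ) where
  toFun f := fun k => f (k * g)
  map_add' _ _ := rfl
  map_smul' _ _ := rfl

/-- The space `V_χ^{K_n}`: functions on `K` (extended by zero off `K`) satisfying
`f(bk) = χ(b₁₁) f(k)` for `b ∈ 𝓑` and right `K_n`-invariance. -/
def Vsp (S : USetting E) (χ : E → ℂ) (n : ℤ) : Submodule ℂ (Mat E → ℂ) where
  carrier := {f | (∀ x, x ∉ Kset S → f x = 0) ∧
    (∀ b ∈ Bcal S, ∀ k ∈ Kset S, f (b * k) = χ (b 0 0) * f k) ∧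
    (∀ k ∈ Kset S, ∀ g ∈ Kfil S n, f (k * g) = f k)}
  add_mem' := by
    rintro f g ⟨hf0, hf1, hf2⟩ ⟨hg0, hg1, hg2⟩
    refine ⟨fun x hx => ?_, fun b hb k hk => ?_, fun k hk g' hg' => ?_⟩
    · simp [hf0 x hx, hg0 x hx]
    · simp only [Pi.add_apply, hf1 b hb k hk, hg1 b hb k hk]; ring
    · simp only [Pi.add_apply, hf2 k hk g' hg', hg2 k hk g' hg']
  zero_mem' := by
    refine ⟨fun x _ => rfl, fun b _ k _ => by simp, fun k _ g _ => rfl⟩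
  smul_mem' := by
    rintro c f ⟨hf0, hf1, hf2⟩
    refine ⟨fun x hx => ?_, fun b hb k hk => ?_, fun k hk g' hg' => ?_⟩
    · simp [hf0 x hx]
    · simp only [Pi.smul_apply, hf1 b hb k hk, smul_eq_mul]; ring
    · simp only [Pi.smul_apply, hf2 k hk g' hg']

/-- The space of the representation induced from a character `Ψ` of a subgroup `H ⊆ K`:
functions on `K` (extended by zero) with `f(hk) = Ψ(h) f(k)`. -/
def IndSp (S : USetting E) (H : Set (Mat E)) (Ψ : Mat E → ℂ) : Submodule ℂ (Mat E → ℂ) where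
  carrier := {f | (∀ x, x ∉ Kset S → f x = 0) ∧
    ∀ h ∈ H, ∀ k ∈ Kset S, f (h * k) = Ψ h * f k}
  add_mem' := by
    rintro f g ⟨hf0, hf1⟩ ⟨hg0, hg1⟩
    refine ⟨fun x hx => ?_, fun h hh k hk => ?_⟩
    · simp [hf0 x hx, hg0 x hx]
    · simp only [Pi.add_apply, hf1 h hh k hk, hg1 h hh k hk]; ring
  zero_mem' := ⟨fun x _ => rfl, fun h _ k _ => by simp⟩
  smul_mem' := by
    rintro c f ⟨hf0, hf1⟩
    refine ⟨fun x hx => ?_, fun h hh k hk => ?_⟩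
    · simp [hf0 x hx]
    · simp only [Pi.smul_apply, hf1 h hh k hk, smul_eq_mul]; ring

/-- The functions constant on `K` and zero off `K`. -/
def ConstSub (S : USetting E) : Submodule ℂ (Mat E → ℂ) where
  carrier := {f | (∀ x, x ∉ Kset S → f x = 0) ∧ ∃ c : ℂ, ∀ k ∈ Kset S, f k = c}
  add_mem' := by
    rintro f g ⟨hf0, c, hc⟩ ⟨hg0, c', hc'⟩
    exact ⟨fun x hx => by simp [hf0 x hx, hg0 x hx],
      c + c', fun k hk => by simp [hc k hk, hc' k hk]⟩
  zero_mem' := ⟨fun x _ => rfl, 0, fun _ _ => rfl⟩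
  smul_mem' := by
    rintro a f ⟨hf0, c, hc⟩
    exact ⟨fun x hx => by simp [hf0 x hx], a * c, fun k hk => by simp [hc k hk]⟩

/-- A subspace is `K`-invariant. -/
def KInvariant (S : USetting E) (W : Submodule ℂ (Mat E → ℂ)) : Prop :=
  ∀ g ∈ Kset S, ∀ f ∈ W, rho g f ∈ W

/-- A subset `A ⊆ K` acts trivially on `W`. -/
def ActsTrivially (S : USetting E) (A : Set (Mat E)) (W : Submodule ℂ (Mat E → ℂ)) : Prop :=
  ∀ g ∈ A, ∀ f ∈ W, rho g f = f

/-- `W` is an irreducible representation of `K`. -/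
def IsIrredRep (S : USetting E) (W : Submodule ℂ (Mat E → ℂ)) : Prop :=
  W ≠ ⊥ ∧ KInvariant S W ∧
    ∀ U : Submodule ℂ (Mat E → ℂ), U ≤ W → KInvariant S U → U = ⊥ ∨ U = W

/-- `V` and `W` are isomorphic as representations of `K`. -/
def RepIso (S : USetting E) (V W : Submodule ℂ (Mat E → ℂ)) : Prop :=
  ∃ e : (Mat E → ℂ) →ₗ[ℂ] (Mat E → ℂ), Set.BijOn ⇑e ↑V ↑W ∧
    ∀ g ∈ Kset S, ∀ f ∈ V, e (rho g f) = rho g (e f)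

/-- The space of `ℂ`-linear endomorphisms of `V` commuting with the right-translation
action of `K`, realized inside the function space `↥V → ↥V`. -/
def Commutant (S : USetting E) (V : Submodule ℂ (Mat E → ℂ)) :
    Submodule ℂ (↥V → ↥V) where
  carrier := {T | (∀ x y : ↥V, T (x + y) = T x + T y) ∧
    (∀ (c : ℂ) (x : ↥V), T (c • x) = c • T x) ∧
    ∀ g ∈ Kset S, ∀ f : ↥V, ∀ h : rho g (f : Mat E → ℂ) ∈ V,
      ((T ⟨rho g (f : Mat E → ℂ), h⟩ : ↥V) : Mat E → ℂ) = rho g ((T f : ↥V) : Mat E → ℂ)}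
  add_mem' := by
    rintro T T' ⟨hT1, hT2, hT3⟩ ⟨hT1', hT2', hT3'⟩
    refine ⟨fun x y => ?_, fun c x => ?_, fun g hg f h => ?_⟩
    · simp only [Pi.add_apply, hT1 x y, hT1' x y]; abel
    · simp only [Pi.add_apply, hT2 c x, hT2' c x, smul_add]
    · simp only [Pi.add_apply, Submodule.coe_add, hT3 g hg f h, hT3' g hg f h, map_add]
  zero_mem' := by
    refine ⟨fun x y => by simp, fun c x => by simp, fun g hg f h => by simp⟩
  smul_mem' := by
    rintro c T ⟨hT1, hT2, hT3⟩
    refine ⟨fun x y => ?_, fun a x => ?_, fun g hg f h => ?_⟩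
    · simp only [Pi.smul_apply, hT1 x y, smul_add]
    · simp only [Pi.smul_apply, hT2 a x, smul_comm c a]
    · simp only [Pi.smul_apply, Submodule.coe_smul, hT3 g hg f h, _root_.map_smul]

/-- The additive character `ψ` of `E`, `ψ(x) = ψ'((x + σ(x))/2)`. -/
def psiE (S : USetting E) (x : E) : ℂ := S.psi' ((x + S.sig x) / 2)

/-- `Ψ_Y(g) = ψ(Tr(Y (g − 1)))`. -/
def PsiC (S : USetting E) (Y g : Mat E) : ℂ := psiE S ((Y * (g - 1)).trace)

/-- The Lie algebra `𝔤 = 𝔲(1,1)(F)`. -/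
def gfrak (S : USetting E) : Set (Mat E) :=
  {Y | (Y.map ⇑S.sig)ᵀ * w0 E + w0 E * Y = 0}

/-- The lattice `𝔨_s` of the Lie algebra, where `c = ⌈s⌉`. -/
def kfrakC (S : USetting E) (c : ℤ) : Set (Mat E) :=
  {Y | Y ∈ gfrak S ∧ (c : WithTop ℤ) ≤ S.nu (Y 0 0) ∧ (c : WithTop ℤ) ≤ S.nu (Y 1 1) ∧
    (∃ t, S.sig t = t ∧ (c : WithTop ℤ) ≤ S.nu t ∧ Y 0 1 = S.sqeps * t) ∧
    (∃ t, S.sig t = t ∧ (c : WithTop ℤ) ≤ S.nu t ∧ Y 1 0 = S.sqeps * t)}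

/-- The group `J_d`. -/
def Jgrp (S : USetting E) (d : ℕ) : Set (Mat E) :=
  {g | g ∈ Kset S ∧ ((((d + 1) / 2 : ℕ) : WithTop ℤ) ≤ S.nu (g 0 0 - 1)) ∧
    ((((d + 1) / 2 : ℕ) : WithTop ℤ) ≤ S.nu (g 0 1)) ∧
    ((((d + 1) / 2 : ℕ) : WithTop ℤ) ≤ S.nu (g 1 1 - 1)) ∧
    (((d / 2 + 1 : ℕ) : WithTop ℤ) ≤ S.nu (g 1 0))}

/-- The centralizer `T(X)` in `K` of `X = [[z√ε, u√ε],[v√ε, z√ε]]`. -/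
def TXset (S : USetting E) (u v : E) : Set (Mat E) :=
  {m | m ∈ Kset S ∧ m 1 1 = m 0 0 ∧ m 1 0 = m 0 1 * (u⁻¹ * v)}

/-- The center `Z` of `G`, identified with scalar matrices with entries in `E^1`. -/
def Zset (S : USetting E) : Set (Mat E) := {m | ∃ z ∈ E1set S, m = z • (1 : Mat E)}

/-- `𝒰 = U ∩ K`. -/
def Uset (S : USetting E) : Set (Mat E) :=
  {m | ∃ b, S.sig b = b ∧ 0 ≤ S.nu b ∧ m = !![1, b * S.sqeps; 0, 1]}

/-- The set of products `T(X)·J_d`. -/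
def TXJ (S : USetting E) (u v : E) (d : ℕ) : Set (Mat E) :=
  {x | ∃ t ∈ TXset S u v, ∃ j ∈ Jgrp S d, x = t * j}

/-- The set of products `Z·𝒰·J_d`. -/
def ZUJ (S : USetting E) (d : ℕ) : Set (Mat E) :=
  {x | ∃ z ∈ Zset S, ∃ m ∈ Uset S, ∃ j ∈ Jgrp S d, x = z * m * j}

/-- `X = [[z√ε, u√ε],[v√ε, z√ε]]`. -/
def Xzuv (S : USetting E) (z u v : E) : Mat E :=
  !![z * S.sqeps, u * S.sqeps; v * S.sqeps, z * S.sqeps]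

/-- The nilpotent element `X_δ = [[0, δ√ε],[0,0]]`. -/
def Xdelta (S : USetting E) (δ : E) : Mat E := !![0, δ * S.sqeps; 0, 0]

/-- `W` is a `K`-invariant complement of `V_χ^{K_d}` inside `V_χ^{K_{d+1}}`. -/
def Wcompl (S : USetting E) (χ : E → ℂ) (d : ℕ) (W : Submodule ℂ (Mat E → ℂ)) : Prop :=
  W ≤ Vsp S χ ((d : ℤ) + 1) ∧ KInvariant S W ∧
    Vsp S χ (d : ℤ) ⊓ W = ⊥ ∧ Vsp S χ (d : ℤ) ⊔ W = Vsp S χ ((d : ℤ) + 1)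

namespace USetting

lemma nu_one (S : USetting E) : S.nu 1 = 0 := by
  have h := S.nu_mul 1 1
  rw [mul_one] at h
  have h' : S.nu 1 ≠ ⊤ := fun h => one_ne_zero ((S.nu_eq_top 1).1 h)
  lift S.nu 1 to ℤ using h' with n
  norm_cast at h ⊢
  omega

lemma eq_zero_of_add_self_eq_zero {x : WithTop ℤ} (h : x + x = 0) : x = 0 := by
  have h' : x ≠ ⊤ := by rintro rfl; simp at h
  lift x to ℤ using h'
  norm_cast at h ⊢
  omega

lemma nu_neg (S : USetting E) (x : E) : S.nu (-x) = S.nu x := by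
  have h : S.nu (-1) = 0 := by
    apply eq_zero_of_add_self_eq_zero
    rw [← S.nu_mul, neg_one_mul, neg_neg, S.nu_one]
  rw [← neg_one_mul, S.nu_mul, h, zero_add]

lemma le_nu_add (S : USetting E) {n : WithTop ℤ} {x y : E} (hx : n ≤ S.nu x)
    (hy : n ≤ S.nu y) : n ≤ S.nu (x + y) :=
  (le_min hx hy).trans (S.nu_add x y)

lemma le_nu_sub (S : USetting E) {n : WithTop ℤ} {x y : E} (hx : n ≤ S.nu x)
    (hy : n ≤ S.nu y) : n ≤ S.nu (x - y) := by
  rw [sub_eq_add_neg]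
  exact S.le_nu_add hx (by rwa [nu_neg])

lemma le_nu_mul (S : USetting E) {m n : WithTop ℤ} {x y : E} (hx : m ≤ S.nu x)
    (hy : n ≤ S.nu y) : m + n ≤ S.nu (x * y) := by
  rw [S.nu_mul]
  exact add_le_add hx hy

lemma le_nu_mul_left (S : USetting E) {n : WithTop ℤ} {x y : E} (hx : 0 ≤ S.nu x)
    (hy : n ≤ S.nu y) : n ≤ S.nu (x * y) := by
  simpa using S.le_nu_mul hx hy

lemma le_nu_mul_right (S : USetting E) {n : WithTop ℤ} {x y : E} (hx : n ≤ S.nu x)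
    (hy : 0 ≤ S.nu y) : n ≤ S.nu (x * y) := by
  simpa using S.le_nu_mul hx hy

lemma le_nu_sig (S : USetting E) {n : WithTop ℤ} {x : E} (hx : n ≤ S.nu x) :
    n ≤ S.nu (S.sig x) := by
  rwa [S.nu_sig]

lemma ne_zero_of_nu (S : USetting E) {x : E} (h : S.nu x = 0) : x ≠ 0 := by
  intro h'
  rw [(S.nu_eq_top x).2 h'] at h
  simp at h

lemma nu_inv (S : USetting E) {x : E} (h : S.nu x = 0) : S.nu x⁻¹ = 0 := by
  have := S.nu_mul x x⁻¹
  rw [mul_inv_cancel₀ (S.ne_zero_of_nu h), S.nu_one, h, zero_add] at this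
  exact this.symm

lemma nu_eq_zero_of_nu_mul_eq_zero (S : USetting E) {x y : E} (hx : 0 ≤ S.nu x)
    (hy : 0 ≤ S.nu y) (h : S.nu (x * y) = 0) : S.nu x = 0 := by
  rw [S.nu_mul] at h
  exact le_antisymm (h ▸ le_add_of_nonneg_right hy) hx

lemma nu_eq_zero_of_one_le_nu_sub_one (S : USetting E) {x : E} (h : 1 ≤ S.nu (x - 1)) : S.nu x = 0 := by
  have hx : 0 ≤ S.nu x := by
    have := S.le_nu_add (zero_le_one.trans h) S.nu_one.ge
    rwa [sub_add_cancel] at this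
  refine le_antisymm (not_lt.1 fun hlt => ?_) hx
  have h1 : 1 ≤ S.nu x := by
    generalize S.nu x = t at hlt
    cases t with
    | top => simp
    | coe t => norm_cast at hlt ⊢
  have := S.le_nu_sub h1 h
  rw [sub_sub_cancel, S.nu_one] at this
  exact absurd this (by decide)

lemma eq_zero_of_forall_le (S : USetting E) {x : E}
    (h : ∀ n : ℕ, ((n : ℤ) : WithTop ℤ) ≤ S.nu x) : x = 0 := by
  rw [← S.nu_eq_top]
  by_contra hne
  lift S.nu x to ℤ using hne with t
  have := h (t.toNat + 1)
  norm_cast at this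
  omega

/-- The iteration `x ↦ x - (x² - M) / 2`, started at `1`, converging to a square root of `M`. -/
def sqrtApprox (M : E) : ℕ → E
  | 0 => 1
  | n + 1 => sqrtApprox M n - 2⁻¹ * (sqrtApprox M n ^ 2 - M)

lemma sqrtApprox_spec (S : USetting E) {s : ℕ} (hs : 1 ≤ s) {M : E} (hM : S.sig M = M)
    (hM1 : ((s : ℤ) : WithTop ℤ) ≤ S.nu (M - 1)) (n : ℕ) :
    S.sig (sqrtApprox M n) = sqrtApprox M n ∧
      ((s : ℤ) : WithTop ℤ) ≤ S.nu (sqrtApprox M n - 1) ∧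
      (((s + n : ℕ) : ℤ) : WithTop ℤ) ≤ S.nu (sqrtApprox M n ^ 2 - M) := by
  have h2 := (S.nu_inv S.nu_two).ge
  induction n with
  | zero =>
    refine ⟨by simp [sqrtApprox], ?_, ?_⟩
    · rw [sqrtApprox, sub_self, (S.nu_eq_top 0).2 rfl]
      exact le_top
    · rw [sqrtApprox, one_pow, ← neg_sub, nu_neg]
      exact hM1
  | succ n ih =>
    obtain ⟨h1, h3, h4⟩ := ih
    have hle : ((s : ℤ) : WithTop ℤ) ≤ (((s + n : ℕ) : ℤ) : WithTop ℤ) := by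
      norm_cast
      omega
    refine ⟨?_, ?_, ?_⟩
    · simp only [sqrtApprox, map_sub, map_mul, map_pow, map_inv₀, map_ofNat, h1, hM]
    · rw [sqrtApprox, sub_right_comm]
      exact S.le_nu_sub h3 (S.le_nu_mul_left h2 (hle.trans h4))
    · have key : sqrtApprox M (n + 1) ^ 2 - M =
          (2⁻¹ * (sqrtApprox M n ^ 2 - M)) * (2⁻¹ * (sqrtApprox M n ^ 2 - M)) -
            (sqrtApprox M n - 1) * (sqrtApprox M n ^ 2 - M) := by
        have : (2 : E) ≠ 0 := S.ne_zero_of_nu S.nu_two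
        rw [sqrtApprox]
        field_simp
        ring
      have hstep : (((s + (n + 1) : ℕ) : ℤ) : WithTop ℤ) ≤
          ((s : ℤ) : WithTop ℤ) + (((s + n : ℕ) : ℤ) : WithTop ℤ) := by
        norm_cast
        omega
      have h5 := S.le_nu_mul_left h2 h4
      rw [key]
      exact S.le_nu_sub (hstep.trans (S.le_nu_mul (hle.trans h5) h5))
        (hstep.trans (S.le_nu_mul h3 h4))

lemma exists_sqrt (S : USetting E) {s : ℕ} (hs : 1 ≤ s) {M : E} (hM : S.sig M = M)
    (hM1 : ((s : ℤ) : WithTop ℤ) ≤ S.nu (M - 1)) :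
    ∃ L, S.sig L = L ∧ L ^ 2 = M ∧ ((s : ℤ) : WithTop ℤ) ≤ S.nu (L - 1) := by
  have spec := S.sqrtApprox_spec hs hM hM1
  have hle (n : ℕ) : ((n : ℤ) : WithTop ℤ) ≤ (((s + n : ℕ) : ℤ) : WithTop ℤ) := by
    norm_cast
    omega
  obtain ⟨L, hL⟩ := S.complete (sqrtApprox M) fun n => by
    rw [sqrtApprox, sub_sub_cancel_left, nu_neg]
    exact S.le_nu_mul_left (S.nu_inv S.nu_two).ge ((hle n).trans (spec n).2.2)
  have hs0 : (0 : WithTop ℤ) ≤ ((s : ℤ) : WithTop ℤ) := by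
    norm_cast
    omega
  have hL1 : ((s : ℤ) : WithTop ℤ) ≤ S.nu (L - 1) := by
    have := S.le_nu_add (hL s) (spec s).2.1
    rwa [sub_add_sub_cancel] at this
  have int_of {x : E} (h : ((s : ℤ) : WithTop ℤ) ≤ S.nu (x - 1)) : 0 ≤ S.nu x := by
    have := S.le_nu_add (hs0.trans h) S.nu_one.ge
    rwa [sub_add_cancel] at this
  refine ⟨L, ?_, ?_, hL1⟩
  · refine sub_eq_zero.1 (S.eq_zero_of_forall_le fun n => ?_)
    have := S.le_nu_sub (S.le_nu_sig (hL n)) (hL n)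
    rwa [map_sub, (spec n).1, sub_sub_sub_cancel_right] at this
  · refine sub_eq_zero.1 (S.eq_zero_of_forall_le fun n => ?_)
    have h := S.le_nu_add
      (S.le_nu_mul_right (hL n) (S.le_nu_add (int_of hL1) (int_of (spec n).2.1)))
      ((hle n).trans (spec n).2.2)
    convert h using 2
    ring

end USetting

lemma mem_Gset_iff (S : USetting E) (a b c d : E) :
    !![a, b; c, d] ∈ Gset S ↔
      S.sig c * a + S.sig a * c = 0 ∧ S.sig c * b + S.sig a * d = 1 ∧
      S.sig d * a + S.sig b * c = 1 ∧ S.sig d * b + S.sig b * d = 0 := by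
  simp only [Gset, Set.mem_ofPred_eq, w0]
  rw [← Matrix.ext_iff]
  simp [Fin.forall_fin_two, Matrix.mul_apply, Fin.sum_univ_two, and_assoc]

lemma mul_mem_Gset (S : USetting E) {g h : Mat E} (hg : g ∈ Gset S) (hh : h ∈ Gset S) :
    g * h ∈ Gset S := by
  simp only [Gset, Set.mem_ofPred_eq] at *
  rw [Matrix.map_mul, Matrix.transpose_mul]
  calc _ = (h.map S.sig)ᵀ * ((g.map S.sig)ᵀ * w0 E * g) * h := by simp only [Matrix.mul_assoc]
    _ = _ := by rw [hg, hh]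

lemma nu_det_of_mem_Gset (S : USetting E) {g : Mat E} (hg : g ∈ Gset S) : S.nu g.det = 0 := by
  have h := congrArg Matrix.det (show (g.map S.sig)ᵀ * w0 E * g = w0 E from hg)
  have hw : (w0 E).det = -1 := by simp [w0, Matrix.det_fin_two]
  have hs : (g.map S.sig).det = S.sig g.det := (S.sig.map_det g).symm
  rw [Matrix.det_mul, Matrix.det_mul, Matrix.det_transpose, hs, hw] at h
  have h1 : S.sig g.det * g.det = 1 := by linear_combination -h
  apply USetting.eq_zero_of_add_self_eq_zero
  rw [← S.nu_one, ← h1, S.nu_mul, S.nu_sig]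

lemma mem_Kset_of_mem_Gset (S : USetting E) {g : Mat E} (hg : g ∈ Gset S)
    (h : ∀ i j, 0 ≤ S.nu (g i j)) : g ∈ Kset S :=
  ⟨hg, h, nu_det_of_mem_Gset S hg⟩

lemma le_nu_mul_apply (S : USetting E) {n : WithTop ℤ} {g h : Mat E}
    (hg : ∀ i j, 0 ≤ S.nu (g i j)) (hh : ∀ i j, n ≤ S.nu (h i j)) (i j : Fin 2) :
    n ≤ S.nu ((g * h) i j) := by
  rw [Matrix.mul_apply, Fin.sum_univ_two]
  exact S.le_nu_add (S.le_nu_mul_left (hg _ _) (hh _ _)) (S.le_nu_mul_left (hg _ _) (hh _ _))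

/-- if `k = [[a,b],[c,d]] ∈ K` satisfies `a ≡ d` and `c ≡ u⁻¹v·b` modulo
`p_E^s`, then there are `a′, b′ ∈ O_E` congruent to `a, b` modulo `p_E^s` such that
`k′ = [[a′, b′],[b′u⁻¹v, a′]] ∈ K`; in particular `(k′)⁻¹ k ∈ K_s`. -/
theorem stmt19 (S : USetting E) (s : ℕ) (hs : 1 ≤ s) (u v : E)
    (hu : S.sig u = u) (hv : S.sig v = v) (hnu : S.nu u = 0) (hnv : 0 < S.nu v)
    (a b c d : E) (hk : !![a, b; c, d] ∈ Kset S)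
    (had : ((s : ℤ) : WithTop ℤ) ≤ S.nu (a - d))
    (hcb : ((s : ℤ) : WithTop ℤ) ≤ S.nu (c - u⁻¹ * v * b)) :
    ∃ a' b' : E, 0 ≤ S.nu a' ∧ 0 ≤ S.nu b' ∧
      ((s : ℤ) : WithTop ℤ) ≤ S.nu (a' - a) ∧ ((s : ℤ) : WithTop ℤ) ≤ S.nu (b' - b) ∧
      !![a', b'; b' * (u⁻¹ * v), a'] ∈ Kset S ∧
      (!![a', b'; b' * (u⁻¹ * v), a'])⁻¹ * !![a, b; c, d] ∈ Kfil S (s : ℤ) := by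
  have hs1 : (1 : WithTop ℤ) ≤ ((s : ℤ) : WithTop ℤ) := by
    norm_cast
  have hs0 : (0 : WithTop ℤ) ≤ ((s : ℤ) : WithTop ℤ) := zero_le_one.trans hs1
  obtain ⟨hG, hint, -⟩ := hk
  have ha : 0 ≤ S.nu a := hint 0 0
  have hb : 0 ≤ S.nu b := hint 0 1
  have hc : 0 ≤ S.nu c := hint 1 0
  have hd : 0 ≤ S.nu d := hint 1 1
  obtain ⟨-, hG01, -, hG11⟩ := (mem_Gset_iff S a b c d).1 hG
  obtain ⟨w, hw⟩ : ∃ w, w = u⁻¹ * v := ⟨_, rfl⟩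
  have hσw : S.sig w = w := by rw [hw, map_mul, map_inv₀, hu, hv]
  have hw1 : 1 ≤ S.nu w := by
    rw [hw, S.nu_mul, S.nu_inv hnu, zero_add]
    generalize S.nu v = t at hnv
    cases t with
    | top => simp
    | coe t => norm_cast at hnv ⊢
  have hw0 : 0 ≤ S.nu w := zero_le_one.trans hw1
  rw [← hw] at hcb ⊢
  have hc1 : 1 ≤ S.nu c := by
    have := S.le_nu_add (hs1.trans hcb) (S.le_nu_mul_right hw1 hb)
    rwa [sub_add_cancel] at this
  have ha0 : S.nu (S.sig a) = 0 := by
    refine S.nu_eq_zero_of_nu_mul_eq_zero (S.le_nu_sig ha) hd (S.nu_eq_zero_of_one_le_nu_sub_one ?_)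
    have := S.le_nu_mul_right (S.le_nu_sig hc1) hb
    rw [← S.nu_neg] at this
    convert this using 2
    linear_combination hG01
  have hane : S.sig a ≠ 0 := S.ne_zero_of_nu ha0
  have hane' : a ≠ 0 := fun h => hane (by rw [h, map_zero])
  have h2 : (2 : E) ≠ 0 := S.ne_zero_of_nu S.nu_two
  -- Correct `b` so that `σ(a) b₁` has trace zero.
  obtain ⟨t, ht⟩ : ∃ t, t = S.sig a * b + S.sig b * a := ⟨_, rfl⟩
  have hσt : S.sig t = t := by
    simp only [ht, map_add, map_mul, S.sig_invol]
    ring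
  have hts : ((s : ℤ) : WithTop ℤ) ≤ S.nu t := by
    have := S.le_nu_add (S.le_nu_mul_right (S.le_nu_sig had) hb)
      (S.le_nu_mul_left (S.le_nu_sig hb) had)
    convert this using 2
    rw [ht, map_sub]
    linear_combination hG11
  obtain ⟨b₁, hb₁⟩ : ∃ b₁, b₁ = b - 2⁻¹ * (S.sig a)⁻¹ * t := ⟨_, rfl⟩
  have hb₁b : ((s : ℤ) : WithTop ℤ) ≤ S.nu (b₁ - b) := by
    rw [hb₁, sub_sub_cancel_left, S.nu_neg]
    exact S.le_nu_mul_left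
      (S.le_nu_mul_left (S.nu_inv S.nu_two).ge (S.nu_inv ha0).ge) hts
  have hb₁0 : 0 ≤ S.nu b₁ := by
    have := S.le_nu_add (hs0.trans hb₁b) hb
    rwa [sub_add_cancel] at this
  have htr : S.sig a * b₁ + S.sig b₁ * a = 0 := by
    simp only [hb₁, map_sub, map_mul, map_inv₀, S.sig_invol, hσt, map_ofNat]
    field_simp
    linear_combination -2 * ht
  -- Rescale by the inverse square root of the resulting multiplier `N`.
  obtain ⟨N, hN⟩ : ∃ N, N = S.sig a * a + w * (S.sig b₁ * b₁) := ⟨_, rfl⟩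
  have hσN : S.sig N = N := by
    simp only [hN, map_add, map_mul, S.sig_invol, hσw]
    ring
  have hN1 : ((s : ℤ) : WithTop ℤ) ≤ S.nu (N - 1) := by
    have e1 := S.le_nu_mul_left (S.le_nu_sig ha) had
    have e2 := S.le_nu_mul_right (S.le_nu_sig hcb) hb
    have e3 := S.le_nu_mul_left hw0 (S.le_nu_add
      (S.le_nu_mul_right (S.le_nu_sig hb₁b) hb₁0) (S.le_nu_mul_left (S.le_nu_sig hb) hb₁b))
    have := S.le_nu_add (S.le_nu_sub e1 e2) e3
    convert this using 2
    simp only [hN, map_sub, map_mul, hσw]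
    linear_combination hG01
  obtain ⟨L, hσL, hL2, hL1⟩ := S.exists_sqrt hs hσN hN1
  have hL0 : S.nu L = 0 := S.nu_eq_zero_of_one_le_nu_sub_one (hs1.trans hL1)
  have hLne : L ≠ 0 := S.ne_zero_of_nu hL0
  have hLi0 : 0 ≤ S.nu L⁻¹ := (S.nu_inv hL0).ge
  have hLi1 : ((s : ℤ) : WithTop ℤ) ≤ S.nu (L⁻¹ - 1) := by
    have := S.le_nu_mul_left hLi0 hL1
    rw [← S.nu_neg] at this
    convert this using 2
    field_simp
    ring
  obtain ⟨a', ha'⟩ : ∃ a', a' = L⁻¹ * a := ⟨_, rfl⟩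
  obtain ⟨b', hb'⟩ : ∃ b', b' = L⁻¹ * b₁ := ⟨_, rfl⟩
  have ha'0 : 0 ≤ S.nu a' := ha' ▸ S.le_nu_mul_left hLi0 ha
  have hb'0 : 0 ≤ S.nu b' := hb' ▸ S.le_nu_mul_left hLi0 hb₁0
  have ha's : ((s : ℤ) : WithTop ℤ) ≤ S.nu (a' - a) := by
    convert S.le_nu_mul_right hLi1 ha using 2
    rw [ha']
    ring
  have hb's : ((s : ℤ) : WithTop ℤ) ≤ S.nu (b' - b) := by
    convert S.le_nu_add (S.le_nu_mul_right hLi1 hb₁0) hb₁b using 2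
    rw [hb']
    ring
  have htr' : S.sig a' * b' + S.sig b' * a' = 0 := by
    simp only [ha', hb', map_mul, map_inv₀, hσL]
    linear_combination L⁻¹ * L⁻¹ * htr
  have hnorm' : S.sig a' * a' + w * (S.sig b' * b') = 1 := by
    simp only [ha', hb', map_mul, map_inv₀, hσL]
    field_simp
    linear_combination -hN - hL2
  have hG' : !![a', b'; b' * w, a'] ∈ Gset S := by
    rw [mem_Gset_iff, map_mul, hσw]
    refine ⟨?_, ?_, ?_, ?_⟩
    · linear_combination w * htr'
    · linear_combination hnorm'
    · linear_combination hnorm'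
    · linear_combination htr'
  have hGi : !![S.sig a', S.sig b'; S.sig b' * w, S.sig a'] ∈ Gset S := by
    rw [mem_Gset_iff, map_mul, hσw]
    simp only [S.sig_invol]
    refine ⟨?_, ?_, ?_, ?_⟩
    · linear_combination w * htr'
    · linear_combination hnorm'
    · linear_combination hnorm'
    · linear_combination htr'
  have hinv : !![S.sig a', S.sig b'; S.sig b' * w, S.sig a'] * !![a', b'; b' * w, a'] = 1 := by
    rw [Matrix.one_fin_two, Matrix.mul_fin_two, ← Matrix.ext_iff]
    simp only [Fin.forall_fin_two, Matrix.of_apply, Matrix.cons_val_zero, Matrix.cons_val_one]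
    refine ⟨⟨?_, ?_⟩, ?_, ?_⟩
    · linear_combination hnorm'
    · linear_combination htr'
    · linear_combination w * htr'
    · linear_combination hnorm'
  have hintk' : ∀ i j, 0 ≤ S.nu (!![a', b'; b' * w, a'] i j) := by
    simp [Fin.forall_fin_two, ha'0, hb'0, S.le_nu_mul_right hb'0 hw0]
  have hinti : ∀ i j, 0 ≤ S.nu (!![S.sig a', S.sig b'; S.sig b' * w, S.sig a'] i j) := by
    simp [Fin.forall_fin_two, S.nu_sig, ha'0, hb'0, S.le_nu_mul_right (S.le_nu_sig hb'0) hw0]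
  refine ⟨a', b', ha'0, hb'0, ha's, hb's, mem_Kset_of_mem_Gset S hG' hintk', ?_⟩
  rw [Matrix.inv_eq_left_inv hinv]
  refine ⟨mem_Kset_of_mem_Gset S (mul_mem_Gset S hGi hG) (le_nu_mul_apply S hinti hint), ?_⟩
  rw [← hinv, ← Matrix.mul_sub]
  refine le_nu_mul_apply S hinti ?_
  have hneg {x y : E} (h : ((s : ℤ) : WithTop ℤ) ≤ S.nu (x - y)) :
      ((s : ℤ) : WithTop ℤ) ≤ S.nu (y - x) := by
    rwa [← S.nu_neg, neg_sub]
  have hc's : ((s : ℤ) : WithTop ℤ) ≤ S.nu (c - b' * w) := by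
    convert S.le_nu_sub hcb (S.le_nu_mul_right hb's hw0) using 2
    ring
  have hd's : ((s : ℤ) : WithTop ℤ) ≤ S.nu (d - a') := by
    convert S.le_nu_add (hneg had) (hneg ha's) using 2
    ring
  simpa [Fin.forall_fin_two] using
    And.intro (And.intro (hneg ha's) (hneg hb's)) (And.intro hc's hd's)
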